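/- Single-letterization of the forward rate: Let (X¹_k, X²_k), k = 1, …, n, be i.i.d. pairs of finite-valued random variables, let M₁, M₂ be finite-valued random variables such that M₁, M₂, (X¹_{1:n}, X²_{1:n}) are mutually independent, and let C₁, …, C_r be finite-valued random variables with H(C_i | C_{1:i-1}, X¹_{1:n}, M₁) = 0 for odd i and H(C_i | C_{1:i-1}, X²_{1:n}, M₂) = 0 for even i. Then Σ_{i odd} H(C_i) ≥ Σ_{j=1}^n I(C₁,…,C_r; X¹_j | X²_j, X²_{1:j-1}, X¹_{j+1:n}). -/

import Mathlib

open scoped BigOperators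
open Finset

noncomputable section

namespace Coord

variable {Ω α β γ : Type*}

/-- `p` is a probability mass function on the finite type `α`. -/
def IsPMF [Fintype α] (p : α → ℝ) : Prop := (∀ a, 0 ≤ p a) ∧ ∑ a, p a = 1

/-- ℓ¹ (total variation) distance between two functions on a finite type. -/
def l1dist [Fintype α] (p q : α → ℝ) : ℝ := ∑ a, |p a - q a|

/-- The distribution (pushforward pmf) of the random variable `X` defined on the
finite sample space `Ω` carrying the pmf `μ`. -/
def distr [Fintype Ω] [DecidableEq α] (μ : Ω → ℝ) (X : Ω → α) : α → ℝ :=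
  fun a => ∑ ω, if X ω = a then μ ω else 0

/-- Shannon entropy (base 2) of a pmf. -/
def entFun [Fintype α] (p : α → ℝ) : ℝ := - ∑ a, p a * Real.logb 2 (p a)

/-- Shannon entropy `H(X)` of a random variable `X` on `(Ω, μ)`. -/
def H [Fintype Ω] [Fintype α] [DecidableEq α] (μ : Ω → ℝ) (X : Ω → α) : ℝ :=
  entFun (distr μ X)

/-- Conditional entropy `H(X | Z)`. -/
def condEnt [Fintype Ω] [Fintype α] [Fintype γ] [DecidableEq α] [DecidableEq γ]
    (μ : Ω → ℝ) (X : Ω → α) (Z : Ω → γ) : ℝ :=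
  H μ (fun ω => (X ω, Z ω)) - H μ Z

/-- Mutual information `I(X; Y)`. -/
def mi [Fintype Ω] [Fintype α] [Fintype β] [DecidableEq α] [DecidableEq β]
    (μ : Ω → ℝ) (X : Ω → α) (Y : Ω → β) : ℝ :=
  H μ X + H μ Y - H μ (fun ω => (X ω, Y ω))

/-- Conditional mutual information `I(X; Y | Z)`. -/
def cmi [Fintype Ω] [Fintype α] [Fintype β] [Fintype γ]
    [DecidableEq α] [DecidableEq β] [DecidableEq γ]
    (μ : Ω → ℝ) (X : Ω → α) (Y : Ω → β) (Z : Ω → γ) : ℝ :=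
  H μ (fun ω => (X ω, Z ω)) + H μ (fun ω => (Y ω, Z ω))
    - H μ (fun ω => (X ω, Y ω, Z ω)) - H μ Z

variable {δ : Type*}

section Entropy

variable [Fintype Ω] [DecidableEq α] [DecidableEq β] [DecidableEq γ] [DecidableEq δ] {μ : Ω → ℝ}

lemma distr_nonneg (hμ : IsPMF μ) (X : Ω → α) (a : α) : 0 ≤ distr μ X a :=
  Finset.sum_nonneg fun ω _ => by split_ifs <;> simp [hμ.1 ω]

lemma distr_apply_pos (hμ : IsPMF μ) (X : Ω → α) {ω : Ω} (h : 0 < μ ω) :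
    0 < distr μ X (X ω) := by
  refine Finset.sum_pos' (fun ω _ => by split_ifs <;> simp [hμ.1 ω]) ⟨ω, Finset.mem_univ _, ?_⟩
  simpa using h

lemma sum_distr_mul [Fintype α] (X : Ω → α) (F : α → ℝ) :
    ∑ a, distr μ X a * F a = ∑ ω, μ ω * F (X ω) := by
  simp only [distr, Finset.sum_mul]
  rw [Finset.sum_comm]
  refine Finset.sum_congr rfl fun ω _ => ?_
  simp [ite_mul]

lemma sum_distr [Fintype α] (hμ : IsPMF μ) (X : Ω → α) : ∑ a, distr μ X a = 1 := by
  simpa [hμ.2] using sum_distr_mul (μ := μ) X fun _ => 1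

lemma sum_distr_fst [Fintype α] (X : Ω → α) (Z : Ω → γ) (z : γ) :
    ∑ x, distr μ (fun ω => (X ω, Z ω)) (x, z) = distr μ Z z := by
  simp only [distr]
  rw [Finset.sum_comm]
  refine Finset.sum_congr rfl fun ω _ => ?_
  by_cases h : Z ω = z <;> simp [h]

lemma sum_distr_snd [Fintype γ] (X : Ω → α) (Z : Ω → γ) (x : α) :
    ∑ z, distr μ (fun ω => (X ω, Z ω)) (x, z) = distr μ X x := by
  simp only [distr]
  rw [Finset.sum_comm]
  refine Finset.sum_congr rfl fun ω _ => ?_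
  by_cases h : X ω = x <;> simp [h]

lemma distr_equiv_comp (e : α ≃ β) (X : Ω → α) (b : β) :
    distr μ (fun ω => e (X ω)) b = distr μ X (e.symm b) := by
  simp only [distr, Equiv.eq_symm_apply]

variable [Fintype α] [Fintype β] [Fintype γ] [Fintype δ]

lemma H_eq_sum (X : Ω → α) : H μ X = -∑ ω, μ ω * Real.logb 2 (distr μ X (X ω)) := by
  rw [H, entFun, sum_distr_mul X fun a => Real.logb 2 (distr μ X a)]

/-- Entropy depends only on the partition of the sample space induced by the variable. -/
lemma H_congr {X : Ω → α} {Y : Ω → β} (h : ∀ ω ω', X ω = X ω' ↔ Y ω = Y ω') :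
    H μ X = H μ Y := by
  simp only [H_eq_sum, distr, h]

lemma H_pair_of_distr_eq_mul (hμ : IsPMF μ) (X : Ω → α) (Y : Ω → β) (f : α → ℝ) (g : β → ℝ)
    (h : ∀ a b, distr μ (fun ω => (X ω, Y ω)) (a, b) = f a * g b) :
    H μ (fun ω => (X ω, Y ω)) = H μ X + H μ Y := by
  have hX a : distr μ X a = f a * ∑ b, g b := by
    rw [← sum_distr_snd X Y, Finset.mul_sum]
    exact Finset.sum_congr rfl fun b _ => h a b
  have hY b : distr μ Y b = (∑ a, f a) * g b := by
    rw [← sum_distr_fst X Y, Finset.sum_mul]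
    exact Finset.sum_congr rfl fun a _ => h a b
  have h1 : (∑ a, f a) * ∑ b, g b = 1 := by
    rw [Finset.sum_mul, ← sum_distr hμ X]
    exact Finset.sum_congr rfl fun a _ => (hX a).symm
  have hXY a b : distr μ (fun ω => (X ω, Y ω)) (a, b) = distr μ X a * distr μ Y b := by
    rw [h, hX, hY]
    linear_combination (-(f a * g b)) * h1
  simp only [H_eq_sum, hXY]
  rw [← neg_add, ← Finset.sum_add_distrib]
  congr 1
  refine Finset.sum_congr rfl fun ω _ => ?_
  rcases (hμ.1 ω).eq_or_lt with h0 | h0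
  · simp [← h0]
  · rw [Real.logb_mul (distr_apply_pos hμ X h0).ne' (distr_apply_pos hμ Y h0).ne', mul_add]

lemma cmi_nonneg (hμ : IsPMF μ) (X : Ω → α) (Y : Ω → β) (Z : Ω → γ) : 0 ≤ cmi μ X Y Z := by
  set pxz := distr μ fun ω => (X ω, Z ω) with hpxz
  set pyz := distr μ fun ω => (Y ω, Z ω) with hpyz
  set p := distr μ fun ω => (X ω, Y ω, Z ω) with hp
  set pz := distr μ Z with hpz
  set q : α × β × γ → ℝ :=
    fun t => pxz (t.1, t.2.2) * pyz (t.2.1, t.2.2) / (p t * pz t.2.2) with hq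
  have hcmi : cmi μ X Y Z = ∑ ω, μ ω * (Real.logb 2 (p (X ω, Y ω, Z ω)) + Real.logb 2 (pz (Z ω))
      - Real.logb 2 (pxz (X ω, Z ω)) - Real.logb 2 (pyz (Y ω, Z ω))) := by
    simp only [cmi, H_eq_sum, mul_add, mul_sub, Finset.sum_add_distrib, Finset.sum_sub_distrib,
      hp, hpz, hpxz, hpyz]
    ring
  have hpt (ω) : μ ω * ((1 - q (X ω, Y ω, Z ω)) / Real.log 2) ≤
      μ ω * (Real.logb 2 (p (X ω, Y ω, Z ω)) + Real.logb 2 (pz (Z ω))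
      - Real.logb 2 (pxz (X ω, Z ω)) - Real.logb 2 (pyz (Y ω, Z ω))) := by
    rcases (hμ.1 ω).eq_or_lt with h0 | h0
    · simp [← h0]
    refine mul_le_mul_of_nonneg_left ?_ h0.le
    have h1 : 0 < p (X ω, Y ω, Z ω) := distr_apply_pos hμ (fun ω => (X ω, Y ω, Z ω)) h0
    have h2 : 0 < pz (Z ω) := distr_apply_pos hμ Z h0
    have h3 : 0 < pxz (X ω, Z ω) := distr_apply_pos hμ (fun ω => (X ω, Z ω)) h0
    have h4 : 0 < pyz (Y ω, Z ω) := distr_apply_pos hμ (fun ω => (Y ω, Z ω)) h0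
    simp only [Real.logb, ← add_div, ← sub_div]
    refine div_le_div_of_nonneg_right ?_ (Real.log_nonneg (by norm_num))
    have h5 := Real.log_le_sub_one_of_pos (show 0 < q (X ω, Y ω, Z ω) by
      simp only [hq]; positivity)
    simp only [hq] at h5 ⊢
    rw [Real.log_div (by positivity) (by positivity), Real.log_mul h3.ne' h4.ne',
      Real.log_mul h1.ne' h2.ne'] at h5
    linarith
  have hqsum : ∑ ω, μ ω * q (X ω, Y ω, Z ω) ≤ 1 := by
    rw [← sum_distr_mul (fun ω => (X ω, Y ω, Z ω)) q, ← hp]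
    calc ∑ t, p t * q t
        ≤ ∑ t : α × β × γ, pxz (t.1, t.2.2) * pyz (t.2.1, t.2.2) / pz t.2.2 := by
          refine Finset.sum_le_sum fun t _ => ?_
          have hnn : 0 ≤ pxz (t.1, t.2.2) * pyz (t.2.1, t.2.2) / pz t.2.2 :=
            div_nonneg (mul_nonneg (distr_nonneg hμ _ _) (distr_nonneg hμ _ _))
              (distr_nonneg hμ _ _)
          rcases eq_or_ne (p t) 0 with h0 | h0
          · simpa [h0] using hnn
          · simp only [hq]
            rw [← div_div, div_right_comm, mul_div_cancel₀ _ h0]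
      _ = ∑ z, pz z * pz z / pz z := by
          simp only [Fintype.sum_prod_type]
          rw [Finset.sum_congr rfl fun x _ => Finset.sum_comm, Finset.sum_comm]
          refine Finset.sum_congr rfl fun z _ => ?_
          simp only [← Finset.sum_div, ← Finset.mul_sum, ← Finset.sum_mul]
          rw [hpyz, hpxz, sum_distr_fst, sum_distr_fst]
      _ = 1 := by
          rw [← sum_distr hμ Z]
          exact Finset.sum_congr rfl fun z _ => mul_self_div_self _
  rw [hcmi]
  refine le_trans ?_ (Finset.sum_le_sum fun ω _ => hpt ω)
  have : ∑ ω, μ ω * ((1 - q (X ω, Y ω, Z ω)) / Real.log 2) =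
      (1 - ∑ ω, μ ω * q (X ω, Y ω, Z ω)) / Real.log 2 := by
    simp only [mul_div_assoc', mul_sub, mul_one, ← Finset.sum_div, Finset.sum_sub_distrib, hμ.2]
  rw [this]
  exact div_nonneg (by linarith) (Real.log_nonneg (by norm_num))

/-- Submodularity of entropy: `J` is a joint of `A` and `B`, and `K` is a function of each. -/
lemma H_submodular (hμ : IsPMF μ) {A : Ω → α} {B : Ω → β} {J : Ω → γ} {K : Ω → δ}
    (hJ : ∀ ω ω', J ω = J ω' ↔ A ω = A ω' ∧ B ω = B ω')
    (hA : ∀ ω ω', A ω = A ω' → K ω = K ω') (hB : ∀ ω ω', B ω = B ω' → K ω = K ω') :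
    H μ J + H μ K ≤ H μ A + H μ B := by
  have h := cmi_nonneg hμ A B K
  have hAK : H μ (fun ω => (A ω, K ω)) = H μ A := H_congr fun ω ω' => by
    simpa using hA ω ω'
  have hBK : H μ (fun ω => (B ω, K ω)) = H μ B := H_congr fun ω ω' => by
    simpa using hB ω ω'
  have hABK : H μ (fun ω => (A ω, B ω, K ω)) = H μ J := H_congr fun ω ω' => by
    have := hA ω ω'
    simp only [Prod.mk.injEq, hJ]
    tauto
  rw [cmi, hAK, hBK, hABK] at h
  linarith

/-- If `J` is a joint of `X` and `B`, where `B` refines `Z`, and `X` is independent of `B` given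
`Z`, then `I(W; X | Z) ≤ I(W; X | B)`. -/
lemma cmi_le_of_refines {ε : Type*} [Fintype ε] [DecidableEq ε] (hμ : IsPMF μ) (W : Ω → α)
    {X : Ω → β} {Z : Ω → γ} {B : Ω → δ} {J : Ω → ε}
    (hJ : ∀ ω ω', J ω = J ω' ↔ X ω = X ω' ∧ B ω = B ω')
    (hB : ∀ ω ω', B ω = B ω' → Z ω = Z ω')
    (h : H μ (fun ω => (X ω, Z ω)) - H μ Z = H μ J - H μ B) :
    cmi μ W X Z ≤
      H μ J - H μ (fun ω => (W ω, J ω)) - (H μ B - H μ (fun ω => (W ω, B ω))) := by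
  have hsub := H_submodular hμ (A := fun ω => (W ω, X ω, Z ω)) (B := fun ω => (W ω, B ω))
    (J := fun ω => (W ω, J ω)) (K := fun ω => (W ω, Z ω))
    (fun ω ω' => by have := hB ω ω'; simp only [Prod.mk.injEq, hJ]; tauto)
    (fun ω ω' => by simp only [Prod.mk.injEq]; tauto)
    (fun ω ω' => by have := hB ω ω'; simp only [Prod.mk.injEq]; tauto)
  rw [cmi]
  linarith

lemma H_const (hμ : IsPMF μ) (a : α) : H μ (fun _ => a) = 0 := by
  simp [H_eq_sum, distr, hμ.2]

lemma H_pair_le (hμ : IsPMF μ) (A : Ω → α) (B : Ω → β) :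
    H μ (fun ω => (A ω, B ω)) ≤ H μ A + H μ B := by
  have := H_submodular hμ (A := A) (B := B) (J := fun ω => (A ω, B ω)) (K := fun _ => ())
    (by simp) (by simp) (by simp)
  rwa [H_const hμ, add_zero] at this

lemma H_mono (hμ : IsPMF μ) {A : Ω → α} {B : Ω → β}
    (h : ∀ ω ω', A ω = A ω' → B ω = B ω') : H μ B ≤ H μ A := by
  have := H_submodular hμ (A := A) (B := A) (J := A) (K := B) (by simp) h h
  linarith

/-- Functions of variables with additive entropies again have additive entropies. -/
lemma H_pair_of_determined (hμ : IsPMF μ) {A : Ω → α} {B : Ω → β} {P : Ω → γ} {Q : Ω → δ}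
    (h : H μ (fun ω => (A ω, B ω)) = H μ A + H μ B)
    (hP : ∀ ω ω', A ω = A ω' → P ω = P ω') (hQ : ∀ ω ω', B ω = B ω' → Q ω = Q ω') :
    H μ (fun ω => (P ω, Q ω)) = H μ P + H μ Q := by
  have h1 := H_submodular hμ (A := A) (B := fun ω => (P ω, B ω)) (J := fun ω => (A ω, B ω))
    (K := P) (fun ω ω' => by have := hP ω ω'; simp only [Prod.mk.injEq]; tauto) hP
    (by simp +contextual)
  have h2 := H_submodular hμ (A := B) (B := fun ω => (P ω, Q ω)) (J := fun ω => (P ω, B ω))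
    (K := Q) (fun ω ω' => by have := hQ ω ω'; simp only [Prod.mk.injEq]; tauto) hQ
    (by simp)
  have h3 := H_pair_le hμ P Q
  linarith

end Entropy

lemma H_restrict_pair_of_distr_eq_prod {ι : Type*} [Fintype Ω] [Fintype ι] [DecidableEq ι]
    [Fintype α] [DecidableEq α]
    {μ : Ω → ℝ} (hμ : IsPMF μ) (A : Ω → ι → α) (w : α → ℝ)
    (h : distr μ A = fun a => ∏ k, w (a k)) (p : ι → Prop) [DecidablePred p] :
    H μ (fun ω => ((fun k : {k // p k} => A ω k), (fun k : {k // ¬ p k} => A ω k))) =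
      H μ (fun ω => fun k : {k // p k} => A ω k) +
        H μ (fun ω => fun k : {k // ¬ p k} => A ω k) := by
  refine H_pair_of_distr_eq_mul hμ _ _ (fun a => ∏ k, w (a k)) (fun b => ∏ k, w (b k)) fun a b => ?_
  have he := distr_equiv_comp (μ := μ) (Equiv.piEquivPiSubtypeProd p fun _ => α) A (a, b)
  refine he.trans ?_
  rw [h]
  dsimp only
  rw [← Fintype.prod_subtype_mul_prod_subtype p]
  congr 1
  · refine Finset.prod_congr rfl fun k _ => ?_
    simp [k.2]
  · refine Finset.prod_congr rfl fun k _ => ?_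
    simp [k.2]

/-- The information that an interactive transcript reveals about `X` to the party holding `Y` is
at most the total entropy of the messages not generated from `Y`. -/
lemma transcript_information_le {r : ℕ} {𝓒 : Fin r → Type*}
    [Fintype Ω] [Fintype α] [DecidableEq α] [Fintype β] [DecidableEq β]
    [∀ i, Fintype (𝓒 i)] [∀ i, DecidableEq (𝓒 i)]
    {μ : Ω → ℝ} (hμ : IsPMF μ) (X : Ω → α) (Y : Ω → β) (C : (i : Fin r) → Ω → 𝓒 i)
    (hY : ∀ i : Fin r, (i : ℕ) % 2 = 1 →
      H μ (fun ω => (C i ω, (fun j : Fin (i : ℕ) => C ⟨j.1, j.2.trans i.2⟩ ω), Y ω)) =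
        H μ (fun ω => ((fun j : Fin (i : ℕ) => C ⟨j.1, j.2.trans i.2⟩ ω), Y ω)))
    (m : ℕ) (hm : m ≤ r) :
    cmi μ (fun ω => fun j : Fin m => C ⟨j.1, j.2.trans_le hm⟩ ω) X Y ≤
      ∑ i : Fin m, if (i : ℕ) % 2 = 0 then H μ (C ⟨i.1, i.2.trans_le hm⟩) else 0 := by
  induction m with
  | zero =>
    have h1 : H μ (fun ω => ((fun j : Fin 0 => C ⟨j.1, j.2.trans_le hm⟩ ω), Y ω)) = H μ Y :=
      H_congr fun ω ω' => by simp [funext_iff]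
    have h2 : H μ (fun ω => ((fun j : Fin 0 => C ⟨j.1, j.2.trans_le hm⟩ ω), X ω, Y ω)) =
        H μ (fun ω => (X ω, Y ω)) := H_congr fun ω ω' => by simp [funext_iff]
    simp [cmi, h1, h2]
  | succ m ih =>
    have hm' : m < r := hm
    specialize ih hm'.le
    rw [Fin.sum_univ_castSucc]
    have hpre (ω ω' : Ω) : ((fun j : Fin (m + 1) => C ⟨j.1, j.2.trans_le hm⟩ ω) =
        fun j : Fin (m + 1) => C ⟨j.1, j.2.trans_le hm⟩ ω') ↔
        C ⟨m, hm'⟩ ω = C ⟨m, hm'⟩ ω' ∧ ((fun j : Fin m => C ⟨j.1, j.2.trans hm'⟩ ω) =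
          fun j : Fin m => C ⟨j.1, j.2.trans hm'⟩ ω') := by
      simp only [funext_iff]
      rw [Fin.forall_fin_succ', and_comm]
      rfl
    have hjoint : H μ (fun ω => ((fun j : Fin (m + 1) => C ⟨j.1, j.2.trans_le hm⟩ ω), Y ω)) =
        H μ (fun ω => (C ⟨m, hm'⟩ ω, (fun j : Fin m => C ⟨j.1, j.2.trans hm'⟩ ω), Y ω)) :=
      H_congr fun ω ω' => by simp only [Prod.mk.injEq, hpre, and_assoc]
    have hmono : H μ (fun ω => ((fun j : Fin m => C ⟨j.1, j.2.trans_le hm'.le⟩ ω), X ω, Y ω)) ≤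
        H μ (fun ω => ((fun j : Fin (m + 1) => C ⟨j.1, j.2.trans_le hm⟩ ω), X ω, Y ω)) :=
      H_mono hμ fun ω ω' => by simp only [Prod.mk.injEq, hpre]; tauto
    have hstep : H μ (fun ω => ((fun j : Fin (m + 1) => C ⟨j.1, j.2.trans_le hm⟩ ω), Y ω)) ≤
        H μ (fun ω => ((fun j : Fin m => C ⟨j.1, j.2.trans_le hm'.le⟩ ω), Y ω)) +
          if m % 2 = 0 then H μ (C ⟨m, hm'⟩) else 0 := by
      rw [hjoint]
      split_ifs with h2
      · have := H_pair_le hμ (C ⟨m, hm'⟩)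
          (fun ω => ((fun j : Fin m => C ⟨j.1, j.2.trans_le hm'.le⟩ ω), Y ω))
        linarith
      · have := hY ⟨m, hm'⟩ (by simpa using h2)
        exact (this.trans (add_zero _).symm).le
    simp only [cmi, Fin.val_castSucc, Fin.val_last] at ih ⊢
    linarith

/-- single-letterization of the forward rate. Let `(X¹_k, X²_k)`,
`k = 1, …, n`, be i.i.d. pairs, let `M₁, M₂, (X¹_{1:n}, X²_{1:n})` be mutually
independent, and let `C₁, …, C_r` be interactive messages. Then
`Σ_{odd i} H(C_i) ≥ Σ_{j=1}^n I(C₁,…,C_r; X¹_j | X²_j, X²_{1:j-1}, X¹_{j+1:n})`.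
(Lean index `i : Fin r` corresponds to the 1-based index `i + 1`, so odd 1-based
indices are those with `(i : ℕ) % 2 = 0`.) -/
theorem single_letterization_forward_rate
    {Ω 𝒳₁ 𝒳₂ 𝓜₁ 𝓜₂ : Type} {r n : ℕ} {𝓒 : Fin r → Type}
    [Fintype Ω] [DecidableEq Ω]
    [Fintype 𝒳₁] [DecidableEq 𝒳₁] [Fintype 𝒳₂] [DecidableEq 𝒳₂]
    [Fintype 𝓜₁] [DecidableEq 𝓜₁] [Fintype 𝓜₂] [DecidableEq 𝓜₂]
    [∀ i, Fintype (𝓒 i)] [∀ i, DecidableEq (𝓒 i)]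
    (μ : Ω → ℝ) (hμ : IsPMF μ)
    (X₁ : Ω → Fin n → 𝒳₁) (X₂ : Ω → Fin n → 𝒳₂)
    (w : 𝒳₁ × 𝒳₂ → ℝ)
    -- the pairs (X¹_k, X²_k) are i.i.d. with per-letter distribution w
    (hiid : distr μ (fun ω => fun k : Fin n => (X₁ ω k, X₂ ω k)) =
      fun a => ∏ k, w (a k))
    (M₁ : Ω → 𝓜₁) (M₂ : Ω → 𝓜₂)
    -- M₁, M₂ and the sources are mutually independent
    (hind : distr μ (fun ω => (M₁ ω, M₂ ω, X₁ ω, X₂ ω)) =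
      fun m => distr μ M₁ m.1 * distr μ M₂ m.2.1 *
        distr μ (fun ω => (X₁ ω, X₂ ω)) m.2.2)
    (C : (i : Fin r) → Ω → 𝓒 i)
    (hodd : ∀ i : Fin r, (i : ℕ) % 2 = 0 →
      condEnt μ (C i)
        (fun ω => ((fun j : Fin (i : ℕ) => C ⟨j.1, j.2.trans i.2⟩ ω), X₁ ω, M₁ ω)) = 0)
    (heven : ∀ i : Fin r, (i : ℕ) % 2 = 1 →
      condEnt μ (C i)
        (fun ω => ((fun j : Fin (i : ℕ) => C ⟨j.1, j.2.trans i.2⟩ ω), X₂ ω, M₂ ω)) = 0) :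
    (∑ i ∈ Finset.univ.filter (fun i : Fin r => (i : ℕ) % 2 = 0), H μ (C i)) ≥
      ∑ j : Fin n,
        cmi μ (fun ω => fun i : Fin r => C i ω)
          (fun ω => X₁ ω j)
          (fun ω => (X₂ ω j,
            (fun j' : Fin (j : ℕ) => X₂ ω ⟨j'.1, j'.2.trans j.2⟩),
            (fun j' : Fin (n - ((j : ℕ) + 1)) =>
              X₁ ω ⟨(j : ℕ) + 1 + j'.1, by have h1 := j'.2; omega⟩))) := by
  -- independence of the second party's randomness from the sources
  have hM : H μ (fun ω => ((M₁ ω, M₂ ω), (X₁ ω, X₂ ω))) =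
      H μ (fun ω => (M₁ ω, M₂ ω)) + H μ (fun ω => (X₁ ω, X₂ ω)) := by
    refine H_pair_of_distr_eq_mul hμ _ _ (fun m => distr μ M₁ m.1 * distr μ M₂ m.2)
      (distr μ fun ω => (X₁ ω, X₂ ω)) fun a b => ?_
    have he := distr_equiv_comp (μ := μ) (Equiv.prodAssoc 𝓜₁ 𝓜₂ _).symm
      (fun ω => (M₁ ω, M₂ ω, X₁ ω, X₂ ω)) (a, b)
    refine he.trans ?_
    rw [hind]
    rfl
  have hM₁₂ := H_pair_of_determined hμ hM (P := M₂) (Q := fun ω => (X₁ ω, X₂ ω))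
    (by simp) (by simp)
  have hM₂ := H_pair_of_determined hμ hM (P := M₂) (Q := X₂) (by simp) (by simp)
  -- conditioning on `M₂` only increases the information about `X₁`
  have hinfo : cmi μ (fun ω => fun i : Fin r => C i ω) X₁ X₂ ≤
      cmi μ (fun ω => fun i : Fin r => C i ω) X₁ (fun ω => (X₂ ω, M₂ ω)) := by
    have h1 : H μ (fun ω => (X₁ ω, X₂ ω, M₂ ω)) = H μ (fun ω => (M₂ ω, X₁ ω, X₂ ω)) :=
      H_congr fun ω ω' => by simp only [Prod.mk.injEq]; tauto
    have h2 : H μ (fun ω => (X₂ ω, M₂ ω)) = H μ (fun ω => (M₂ ω, X₂ ω)) :=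
      H_congr fun ω ω' => by simp only [Prod.mk.injEq]; tauto
    have h3 := H_submodular hμ (A := fun ω => ((fun i : Fin r => C i ω), X₁ ω, X₂ ω))
      (B := fun ω => ((fun i : Fin r => C i ω), X₂ ω, M₂ ω))
      (J := fun ω => ((fun i : Fin r => C i ω), X₁ ω, X₂ ω, M₂ ω))
      (K := fun ω => ((fun i : Fin r => C i ω), X₂ ω))
      (fun ω ω' => by simp only [Prod.mk.injEq]; tauto)
      (fun ω ω' => by simp only [Prod.mk.injEq]; tauto)
      (fun ω ω' => by simp only [Prod.mk.injEq]; tauto)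
    simp only [cmi]
    linarith
  have htrans := transcript_information_le hμ X₁ (fun ω => (X₂ ω, M₂ ω)) C
    (fun i hi => sub_eq_zero.mp (heven i hi)) r le_rfl
  rw [Finset.sum_filter]
  refine ge_iff_le.mpr (le_trans ?_ (hinfo.trans htrans))
  -- chain rule over the letters, in terms of the tails of `X₁`
  let T (m : ℕ) (ω : Ω) : {k : Fin n // m ≤ k} → 𝒳₁ := fun k => X₁ ω k
  have hT (m : ℕ) (ω ω' : Ω) : T m ω = T m ω' ↔ ∀ k : Fin n, m ≤ k → X₁ ω k = X₁ ω' k := by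
    simp [T, funext_iff]
  let G (m : ℕ) : ℝ := H μ (fun ω => (T m ω, X₂ ω)) -
    H μ (fun ω => ((fun i : Fin r => C i ω), T m ω, X₂ ω))
  have hG : cmi μ (fun ω => fun i : Fin r => C i ω) X₁ X₂ = ∑ j : Fin n, (G j - G (j + 1)) := by
    rw [Fin.sum_univ_eq_sum_range (fun j => G j - G (j + 1)) n, Finset.sum_range_sub']
    have h1 : H μ (fun ω => (T 0 ω, X₂ ω)) = H μ (fun ω => (X₁ ω, X₂ ω)) :=
      H_congr fun ω ω' => by simp [hT, funext_iff]
    have h2 : H μ (fun ω => ((fun i : Fin r => C i ω), T 0 ω, X₂ ω)) =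
        H μ (fun ω => ((fun i : Fin r => C i ω), X₁ ω, X₂ ω)) :=
      H_congr fun ω ω' => by simp [hT, funext_iff]
    have hn (ω ω' : Ω) : T n ω = T n ω' := (hT _ _ _).2 fun k hk => absurd k.2 (by omega)
    have h3 : H μ (fun ω => (T n ω, X₂ ω)) = H μ X₂ :=
      H_congr fun ω ω' => by simp [hn ω ω']
    have h4 : H μ (fun ω => ((fun i : Fin r => C i ω), T n ω, X₂ ω)) =
        H μ (fun ω => ((fun i : Fin r => C i ω), X₂ ω)) :=
      H_congr fun ω ω' => by simp [hn ω ω']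
    simp only [cmi, G, h1, h2, h3, h4]
    ring
  rw [hG]
  refine Finset.sum_le_sum fun j _ => ?_
  have hsuffix (ω ω' : Ω) : ((fun j' : Fin (n - ((j : ℕ) + 1)) =>
      X₁ ω ⟨(j : ℕ) + 1 + j'.1, by have h1 := j'.2; omega⟩) =
      fun j' : Fin (n - ((j : ℕ) + 1)) =>
        X₁ ω' ⟨(j : ℕ) + 1 + j'.1, by have h1 := j'.2; omega⟩) ↔ T (j + 1) ω = T (j + 1) ω' := by
    rw [hT, funext_iff]
    refine ⟨fun h k hk => ?_, fun h j' => h _ (by simp)⟩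
    have := h ⟨k - (j + 1), by omega⟩
    simpa [Nat.add_sub_cancel' hk] using this
  have htail (ω ω' : Ω) : T j ω = T j ω' ↔ X₁ ω j = X₁ ω' j ∧ T (j + 1) ω = T (j + 1) ω' := by
    simp only [hT]
    refine ⟨fun h => ⟨h j le_rfl, fun k hk => h k (by omega)⟩, fun h k hk => ?_⟩
    rcases hk.eq_or_lt with h0 | h0
    · rw [← Fin.ext h0]
      exact h.1
    · exact h.2 k h0
  let U (ω : Ω) : 𝒳₂ × (Fin (j : ℕ) → 𝒳₂) :=
    (X₂ ω j, fun j' : Fin (j : ℕ) => X₂ ω ⟨j'.1, j'.2.trans j.2⟩)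
  have hU (ω ω' : Ω) : U ω = U ω' ↔ ∀ k : Fin n, (k : ℕ) ≤ j → X₂ ω k = X₂ ω' k := by
    simp only [U, Prod.mk.injEq, funext_iff]
    refine ⟨fun h k hk => ?_, fun h => ⟨h j le_rfl, fun k => h _ k.2.le⟩⟩
    rcases hk.eq_or_lt with h0 | h0
    · rw [Fin.ext h0]
      exact h.1
    · exact h.2 ⟨k, h0⟩
  let V (ω : Ω) : {k : Fin n // ¬ (k : ℕ) ≤ j} → 𝒳₁ × 𝒳₂ := fun k => (X₁ ω k, X₂ ω k)
  have hV (ω ω' : Ω) : V ω = V ω' ↔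
      T (j + 1) ω = T (j + 1) ω' ∧ ∀ k : Fin n, ¬ (k : ℕ) ≤ j → X₂ ω k = X₂ ω' k := by
    simp only [V, hT, funext_iff, Subtype.forall, Prod.mk.injEq, not_le, Nat.succ_le_iff]
    exact ⟨fun h => ⟨fun k hk => (h k hk).1, fun k hk => (h k hk).2⟩,
      fun h k hk => ⟨h.1 k hk, h.2 k hk⟩⟩
  have hX₂ (ω ω' : Ω) : X₂ ω = X₂ ω' ↔
      U ω = U ω' ∧ ∀ k : Fin n, ¬ (k : ℕ) ≤ j → X₂ ω k = X₂ ω' k := by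
    rw [hU, funext_iff]
    exact ⟨fun h => ⟨fun k _ => h k, fun k _ => h k⟩,
      fun h k => (em ((k : ℕ) ≤ j)).elim (h.1 k) (h.2 k)⟩
  -- the letters up to `j` are independent of the later ones
  have hsplit := H_restrict_pair_of_distr_eq_prod hμ (fun ω k => (X₁ ω k, X₂ ω k)) w hiid
    (fun k : Fin n => (k : ℕ) ≤ j)
  have hleU (ω ω' : Ω) : ((fun k : {k : Fin n // (k : ℕ) ≤ j} => (X₁ ω k, X₂ ω k)) =
      fun k : {k : Fin n // (k : ℕ) ≤ j} => (X₁ ω' k, X₂ ω' k)) → U ω = U ω' := by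
    simp only [hU, funext_iff, Subtype.forall, Prod.mk.injEq]
    exact fun h k hk => (h k hk).2
  have hleP (ω ω' : Ω) : ((fun k : {k : Fin n // (k : ℕ) ≤ j} => (X₁ ω k, X₂ ω k)) =
      fun k : {k : Fin n // (k : ℕ) ≤ j} => (X₁ ω' k, X₂ ω' k)) →
      (X₁ ω j, U ω) = (X₁ ω' j, U ω') := by
    intro h
    rw [Prod.mk.injEq]
    exact ⟨congrArg Prod.fst (congrFun h ⟨j, le_rfl⟩), hleU ω ω' h⟩
  have hVT (ω ω' : Ω) (h : V ω = V ω') : T (j + 1) ω = T (j + 1) ω' := ((hV ω ω').1 h).1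
  have hPV := H_pair_of_determined hμ hsplit (P := fun ω => (X₁ ω j, U ω)) (Q := V) hleP
    fun _ _ h => h
  have hUV := H_pair_of_determined hμ hsplit (P := U) (Q := V) hleU fun _ _ h => h
  have hPT := H_pair_of_determined hμ hsplit (P := fun ω => (X₁ ω j, U ω)) (Q := T (j + 1)) hleP hVT
  have hUT := H_pair_of_determined hμ hsplit (P := U) (Q := T (j + 1)) hleU hVT
  have e1 : H μ (fun ω => (T j ω, X₂ ω)) = H μ (fun ω => ((X₁ ω j, U ω), V ω)) :=
    H_congr fun ω ω' => by simp only [Prod.mk.injEq, htail, hX₂, hV]; tauto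
  have e2 : H μ (fun ω => (T (j + 1) ω, X₂ ω)) = H μ (fun ω => (U ω, V ω)) :=
    H_congr fun ω ω' => by simp only [Prod.mk.injEq, hX₂, hV]; tauto
  refine cmi_le_of_refines hμ _ (fun ω ω' => ?_) (fun ω ω' => ?_) ?_
  · simp only [Prod.mk.injEq, htail, and_assoc]
  · have := hX₂ ω ω'
    simp only [U, Prod.mk.injEq] at this
    simp only [Prod.mk.injEq, hsuffix]
    tauto
  · rw [e1, e2, hPV, hUV, H_congr (Y := fun ω => ((X₁ ω j, U ω), T (j + 1) ω)),
      H_congr (X := fun ω => (X₂ ω j, _)) (Y := fun ω => (U ω, T (j + 1) ω)), hPT, hUT]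
    · ring
    all_goals
      intro ω ω'
      simp only [U, Prod.mk.injEq, hsuffix, and_assoc]

end Coord
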